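/- Let p be a maximal ideal of 𝓞 with residue field F_p = 𝓞/p. Then #{x ∈ F_p^R : there exists σ ∈ 𝒞 with x_ρ ≠ 0 for all ρ ∈ R∖σ} = (#F_p)^{#R} · Σ μ(d)/N(d), where the sum runs over those d ∈ I^R all of whose components are (possibly zeroth) powers of p, and has only finitely many nonzero terms. -/

import Mathlib

open NumberField

/-- A function on `R → ℕ` whose sums over lower sets `Iic e` only depend on the truncation `e ⊓ 1`
is supported on `Iic 1`. -/
lemma eq_zero_of_sum_Iic_eq_sum_Iic_inf_one {R M : Type*} [Fintype R] [DecidableEq R]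
    [AddCommGroup M] {f : (R → ℕ) → M}
    (hf : ∀ e, ∑ e' ∈ Finset.Iic e, f e' = ∑ e' ∈ Finset.Iic (e ⊓ 1), f e')
    (e : R → ℕ) (he : ¬ e ≤ 1) : f e = 0 := by
  induction e using WellFoundedLT.induction with
  | ind e ih =>
    have he' : e ∉ Finset.Iic (e ⊓ 1) := by
      simpa using he
    have hsub : insert e (Finset.Iic (e ⊓ 1)) ⊆ Finset.Iic e := by
      intro e' h
      rcases Finset.mem_insert.1 h with rfl | h
      · simp
      · exact Finset.mem_Iic.2 ((Finset.mem_Iic.1 h).trans inf_le_left)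
    have hsum := Finset.sum_subset (f := f) hsub fun e' h h' => by
      simp only [Finset.mem_insert, Finset.mem_Iic, le_inf_iff, not_or, not_and] at h h'
      exact ih e' (lt_of_le_of_ne h h'.1) (h'.2 h)
    rw [Finset.sum_insert he', hf e] at hsum
    simpa using hsum

/-- The tuples of ideals dividing a tuple of powers of a maximal ideal `p ≠ ⊥` are the tuples of
smaller powers of `p`. -/
lemma finsum_mem_dvd_pow_eq_sum_Iic {A R M : Type*} [CommRing A] [IsDedekindDomain A] [Fintype R]
    [DecidableEq R] [AddCommMonoid M] {p : Ideal A} [hp : p.IsPrime] (hp0 : p ≠ ⊥)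
    (μ : (R → Ideal A) → M) (e : R → ℕ) :
    ∑ᶠ d ∈ {d : R → Ideal A | (∀ ρ, d ρ ≠ ⊥) ∧ ∀ ρ, p ^ e ρ ≤ d ρ}, μ d =
      ∑ e' ∈ Finset.Iic e, μ (fun ρ => p ^ e' ρ) := by
  have hinj : Function.Injective fun (e' : R → ℕ) (ρ : R) => p ^ e' ρ := fun a b h =>
    funext fun ρ => (Ideal.pow_right_strictAnti p hp0 hp.ne_top).injective (congrFun h ρ)
  have hset : {d : R → Ideal A | (∀ ρ, d ρ ≠ ⊥) ∧ ∀ ρ, p ^ e ρ ≤ d ρ} =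
      (fun (e' : R → ℕ) (ρ : R) => p ^ e' ρ) '' (Finset.Iic e : Finset (R → ℕ)) := by
    ext d
    simp only [Set.mem_ofPred_eq, Set.mem_image, Finset.coe_Iic, Set.mem_Iic]
    constructor
    · rintro ⟨-, h⟩
      choose e' he' hd using fun ρ =>
        (dvd_prime_pow (Ideal.prime_of_isPrime hp0 hp) (e ρ)).1 (Ideal.dvd_iff_le.2 (h ρ))
      exact ⟨e', he', funext fun ρ => (associated_iff_eq.1 (hd ρ)).symm⟩
    · rintro ⟨e', he', rfl⟩
      exact ⟨fun ρ => pow_ne_zero _ hp0, fun ρ => Ideal.pow_le_pow_right (he' ρ)⟩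
  rw [hset, finsum_mem_image hinj.injOn, finsum_mem_coe_finset]

/-- A sum of products of powers of a proper ideal is the unit ideal iff one of the products only
has zero exponents. -/
lemma sum_prod_pow_eq_top_iff {A R ι : Type*} [CommRing A] {p : Ideal A} (hp : p ≠ ⊤)
    (s : Finset ι) (t : ι → Finset R) (e : R → ℕ) :
    ∑ i ∈ s, ∏ ρ ∈ t i, p ^ e ρ = ⊤ ↔ ∃ i ∈ s, ∀ ρ ∈ t i, e ρ = 0 := by
  constructor
  · intro h
    by_contra! hne
    refine hp (top_le_iff.1 (h ▸ ?_))
    rw [Ideal.sum_eq_sup]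
    refine Finset.sup_le fun i hi => ?_
    obtain ⟨ρ, hρ, he⟩ := hne i hi
    exact (Ideal.le_of_dvd (Finset.dvd_prod_of_mem _ hρ)).trans (Ideal.pow_le_self he)
  · rintro ⟨i, hi, h⟩
    rw [Ideal.sum_eq_sup, eq_top_iff]
    refine le_trans ?_ (Finset.le_sup hi)
    rw [Finset.prod_eq_one fun ρ hρ => by rw [h ρ hρ, pow_zero], Ideal.one_eq_top]

open scoped Classical in
/-- The number of `x ∈ F^R` vanishing on the support of `e ≤ 1`, multiplied by `(#F)^{∑ e}`,
equals `(#F)^{#R}`. -/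
lemma card_vanishing_mul_prod_pow {R F : Type*} [Fintype R] [DecidableEq R] [Fintype F]
    [Zero F] {e : R → ℕ} (he : e ≤ 1) :
    ({x : R → F | e ≤ fun ρ => if x ρ = 0 then 1 else 0} : Finset (R → F)).card *
      ∏ ρ, Fintype.card F ^ e ρ = Fintype.card F ^ Fintype.card R := by
  have hpi : ({x : R → F | e ≤ fun ρ => if x ρ = 0 then 1 else 0} : Finset (R → F)) =
      Fintype.piFinset fun ρ => if e ρ = 0 then Finset.univ else {0} := by
    ext x
    simp only [Finset.mem_filter, Finset.mem_univ, true_and, Fintype.mem_piFinset, Pi.le_def]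
    refine forall_congr' fun ρ => ?_
    have h1 : e ρ ≤ 1 := he ρ
    by_cases h0 : e ρ = 0 <;> by_cases hx : x ρ = 0 <;> simp [h0, hx, h1]
  rw [hpi, Fintype.card_piFinset, ← Finset.prod_mul_distrib, ← Finset.card_univ (α := R)]
  refine Finset.prod_eq_pow_card fun ρ _ => ?_
  have h1 : e ρ ≤ 1 := he ρ
  by_cases h0 : e ρ = 0
  · simp [h0]
  · simp [show e ρ = 1 by omega]

open scoped Classical in
/-- Counting `F_p`-points of the universal torsor: the number of `x ∈ F_p^R` having, for some
`σ ∈ 𝒞`, all coordinates outside `σ` nonzero equals `(#F_p)^{#R} · Σ_p μ(d)/N(d)`, where the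
sum runs over tuples of powers of `p` and has finitely many nonzero terms. -/
theorem torsor_point_count_mod_p (K : Type*) [Field K] [NumberField K]
    (R : Type*) [Fintype R] [DecidableEq R]
    (𝒞 : Finset (Finset R)) (h𝒞 : 𝒞.Nonempty)
    (μ : (R → Ideal (𝓞 K)) → ℤ)
    (hμ : ∀ b : R → Ideal (𝓞 K), (∀ ρ, b ρ ≠ ⊥) →
      (if (∑ σ ∈ 𝒞, ∏ ρ ∈ σᶜ, b ρ) = ⊤ then (1 : ℤ) else 0) =
        ∑ᶠ d ∈ {d : R → Ideal (𝓞 K) | (∀ ρ, d ρ ≠ ⊥) ∧ ∀ ρ, b ρ ≤ d ρ}, μ d)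
    (p : Ideal (𝓞 K)) (hp : p.IsMaximal) :
    {e : R → ℕ | (μ (fun ρ => p ^ e ρ) : ℝ) / ∏ ρ, (Ideal.absNorm (p ^ e ρ) : ℝ) ≠ 0}.Finite ∧
    (Nat.card {x : R → (𝓞 K ⧸ p) // ∃ σ ∈ 𝒞, ∀ ρ ∉ σ, x ρ ≠ 0} : ℝ) =
      (Nat.card (𝓞 K ⧸ p) : ℝ) ^ (Fintype.card R) *
        ∑ᶠ e : R → ℕ, (μ (fun ρ => p ^ e ρ) : ℝ) / ∏ ρ, (Ideal.absNorm (p ^ e ρ) : ℝ) := by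
  have hp0 : p ≠ ⊥ := Ring.ne_bot_of_isMaximal_of_not_isField hp (RingOfIntegers.not_isField K)
  have hp1 : p ≠ ⊤ := hp.ne_top
  have : Finite (𝓞 K ⧸ p) := Ideal.finiteQuotientOfFreeOfNeBot p hp0
  have : Fintype (𝓞 K ⧸ p) := Fintype.ofFinite _
  set f : (R → ℕ) → ℤ := fun e => μ fun ρ => p ^ e ρ with hf
  have hsum (e : R → ℕ) : ∑ e' ∈ Finset.Iic e, f e' =
      if ∃ σ ∈ 𝒞, ∀ ρ ∉ σ, e ρ = 0 then 1 else 0 := by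
    rw [hf, ← finsum_mem_dvd_pow_eq_sum_Iic hp0, ← hμ _ fun ρ => pow_ne_zero _ hp0]
    simp only [sum_prod_pow_eq_top_iff hp1, Finset.mem_compl]
  have hzero : ∀ e, ¬ e ≤ 1 → f e = 0 := eq_zero_of_sum_Iic_eq_sum_Iic_inf_one fun e => by
    simp [hsum]
  have hsupp : (Function.support fun e : R → ℕ =>
      (f e : ℝ) / ∏ ρ, (Ideal.absNorm (p ^ e ρ) : ℝ)) ⊆ (Finset.Iic 1 : Finset (R → ℕ)) := by
    intro e he
    by_contra h
    exact he (by simp [hzero e (by simpa using h)])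
  refine ⟨(Finset.finite_toSet _).subset hsupp, ?_⟩
  rw [finsum_eq_sum_of_support_subset _ hsupp, Nat.card_eq_fintype_card, Nat.card_eq_fintype_card]
  have hcount : (Fintype.card {x : R → (𝓞 K ⧸ p) // ∃ σ ∈ 𝒞, ∀ ρ ∉ σ, x ρ ≠ 0} : ℤ) =
      ∑ e ∈ Finset.Iic 1, f e *
        ({x : R → (𝓞 K ⧸ p) | e ≤ fun ρ => if x ρ = 0 then 1 else 0} : Finset _).card := by
    calc
      _ = ∑ x : R → (𝓞 K ⧸ p), ∑ e ∈ Finset.Iic fun ρ => if x ρ = 0 then 1 else 0, f e := by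
        simp [hsum, Fintype.card_subtype]
      _ = ∑ e ∈ Finset.Iic 1,
          ∑ x : R → (𝓞 K ⧸ p) with e ≤ fun ρ => if x ρ = 0 then 1 else 0, f e := by
        refine Finset.sum_comm' fun x e => ?_
        simp only [Finset.mem_univ, Finset.mem_Iic, Finset.mem_filter, true_and]
        refine ⟨fun h => ⟨h, h.trans fun ρ => ?_⟩, fun h => h.1⟩
        dsimp only
        split_ifs <;> simp
      _ = _ := by simp [mul_comm]
  rw [← Int.cast_natCast (R := ℝ) (Fintype.card {x : R → (𝓞 K ⧸ p) // _}), hcount,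
    Finset.mul_sum, Int.cast_sum]
  refine Finset.sum_congr rfl fun e he => ?_
  have hq : (Ideal.absNorm p : ℝ) = Fintype.card (𝓞 K ⧸ p) := by
    rw [Ideal.absNorm_apply, Submodule.cardQuot_apply, Nat.card_eq_fintype_card]
  have hcard := congrArg (Nat.cast (R := ℝ))
    (card_vanishing_mul_prod_pow (F := 𝓞 K ⧸ p) (Finset.mem_Iic.1 he))
  push_cast at hcard
  simp only [map_pow, Nat.cast_pow, hq]
  rw [← hcard]
  push_cast
  field_simp
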